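/- Quantum Hoeffding bound: let ρ and σ be faithful density operators on a finite-dimensional complex Hilbert space, let φ(s) := log Tr[ρ^{1−s}σ^{s}], and for r > 0 define B(r | ρ‖σ) as the supremum of all real numbers c such that there exists a sequence of tests {T_n} (0 ≤ T_n ≤ I on the n-fold tensor power space) with limsup_{n→∞} (1/n)·log Tr[σ^{⊗n} T_n] ≤ −r and lim_{n→∞} (1/n)·log Tr[ρ^{⊗n}(I − T_n)] = −c. Then for every r with 0 < r ≤ D(ρ‖σ), B(r | ρ‖σ) = max_{0≤s<1} (−s·r − φ(s))/(1−s). -/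

import Mathlib

open scoped Matrix ComplexOrder
open Filter

noncomputable section

/-- Real power of a matrix, taken via the spectral decomposition when the matrix is
Hermitian (with the convention `0 ^ t` given by `Real.rpow`), and `0` otherwise. -/
def mpow {n : Type*} [Fintype n] [DecidableEq n] (A : Matrix n n ℂ) (t : ℝ) : Matrix n n ℂ :=
  if h : A.IsHermitian then
    (Matrix.IsHermitian.eigenvectorUnitary h : Matrix n n ℂ) *
      Matrix.diagonal (fun i => ((h.eigenvalues i ^ t : ℝ) : ℂ)) *
      (star (Matrix.IsHermitian.eigenvectorUnitary h : Matrix n n ℂ))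
  else 0

/-- Logarithm of a matrix via the spectral decomposition (Hermitian case), `0` otherwise. -/
def mlog {n : Type*} [Fintype n] [DecidableEq n] (A : Matrix n n ℂ) : Matrix n n ℂ :=
  if h : A.IsHermitian then
    (Matrix.IsHermitian.eigenvectorUnitary h : Matrix n n ℂ) *
      Matrix.diagonal (fun i => ((Real.log (h.eigenvalues i) : ℝ) : ℂ)) *
      (star (Matrix.IsHermitian.eigenvectorUnitary h : Matrix n n ℂ))
  else 0

/-- Exponential of a matrix via the spectral decomposition (Hermitian case), `0` otherwise. -/
def mexp {n : Type*} [Fintype n] [DecidableEq n] (A : Matrix n n ℂ) : Matrix n n ℂ :=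
  if h : A.IsHermitian then
    (Matrix.IsHermitian.eigenvectorUnitary h : Matrix n n ℂ) *
      Matrix.diagonal (fun i => ((Real.exp (h.eigenvalues i) : ℝ) : ℂ)) *
      (star (Matrix.IsHermitian.eigenvectorUnitary h : Matrix n n ℂ))
  else 0

/-- The orthogonal projection onto the span of the eigenvectors of a Hermitian matrix
corresponding to positive eigenvalues, denoted `{A > 0}` in the paper; `0` otherwise. -/
def posProj {n : Type*} [Fintype n] [DecidableEq n] (A : Matrix n n ℂ) : Matrix n n ℂ :=
  if h : A.IsHermitian then
    (Matrix.IsHermitian.eigenvectorUnitary h : Matrix n n ℂ) *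
      Matrix.diagonal (fun i => if 0 < h.eigenvalues i then (1 : ℂ) else 0) *
      (star (Matrix.IsHermitian.eigenvectorUnitary h : Matrix n n ℂ))
  else 0

/-- The `n`-fold tensor (Kronecker) power `ρ^{⊗n}`, as a matrix indexed by `Fin n → Fin d`. -/
def tensorPow {d : ℕ} (ρ : Matrix (Fin d) (Fin d) ℂ) (n : ℕ) :
    Matrix (Fin n → Fin d) (Fin n → Fin d) ℂ :=
  fun v w => ∏ t, ρ (v t) (w t)

/-- Quantum relative entropy `D(ρ‖σ) = Tr[ρ(log ρ − log σ)]`. -/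
def qRelEnt {d : ℕ} (ρ σ : Matrix (Fin d) (Fin d) ℂ) : ℝ :=
  ((ρ * (mlog ρ - mlog σ)).trace).re

/-- `φ(s | ρ‖σ) = log Tr[ρ^{1−s} σ^{s}]`. -/
def qphi {d : ℕ} (ρ σ : Matrix (Fin d) (Fin d) ℂ) (s : ℝ) : ℝ :=
  Real.log (((mpow ρ (1 - s)) * (mpow σ s)).trace.re)


section HelperMat
open Matrix

variable {ι : Type*} [Fintype ι] [DecidableEq ι]

/-- Spectral-type matrix. -/
def specM (U : Matrix ι ι ℂ) (l : ι → ℝ) : Matrix ι ι ℂ :=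
  U * Matrix.diagonal (fun i => (l i : ℂ)) * Uᴴ

lemma specM_trace_mul (U V : Matrix ι ι ℂ) (l m : ι → ℝ) :
    (specM U l * specM V m).trace.re
      = ∑ i, ∑ j, l i * m j * Complex.normSq ((Uᴴ * V) i j) := by
  have h1 : (specM U l * specM V m).trace
      = (Matrix.diagonal (fun i => (l i : ℂ)) * ((Uᴴ * V) *
        (Matrix.diagonal (fun i => (m i : ℂ)) * (Uᴴ * V)ᴴ))).trace := by
    unfold specM
    rw [Matrix.conjTranspose_mul, Matrix.conjTranspose_conjTranspose]
    simp only [Matrix.mul_assoc]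
    rw [Matrix.trace_mul_comm]
    simp only [Matrix.mul_assoc]
  rw [h1]
  generalize Uᴴ * V = K
  simp only [Matrix.trace, Matrix.diag_apply, Matrix.diagonal_mul, Complex.re_sum]
  refine Finset.sum_congr rfl fun i _ => ?_
  rw [Matrix.mul_apply, Finset.mul_sum, Complex.re_sum]
  refine Finset.sum_congr rfl fun j _ => ?_
  rw [Matrix.diagonal_mul, Matrix.conjTranspose_apply]
  have : (l i : ℂ) * (K i j * ((m j : ℂ) * star (K i j)))
      = ((l i * m j * Complex.normSq (K i j) : ℝ) : ℂ) := by
    push_cast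
    rw [← Complex.mul_conj]
    simp only [RCLike.star_def]
    ring
  rw [this, Complex.ofReal_re]

/-- The star algebra homomorphism `v ↦ U diag(v) U*`. -/
def specHom (U : Matrix ι ι ℂ) (hU : U ∈ Matrix.unitaryGroup ι ℂ) :
    (ι → ℂ) →⋆ₐ[ℝ] Matrix ι ι ℂ where
  toFun v := U * Matrix.diagonal v * Uᴴ
  map_one' := by
    have := Matrix.mem_unitaryGroup_iff.1 hU
    rw [Matrix.star_eq_conjTranspose] at this
    simp [this]
  map_zero' := by simp
  map_mul' v w := by
    have := Matrix.mem_unitaryGroup_iff'.1 hU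
    rw [Matrix.star_eq_conjTranspose] at this
    calc U * Matrix.diagonal (v * w) * Uᴴ
        = U * (Matrix.diagonal v * Matrix.diagonal w) * Uᴴ := by
          rw [Matrix.diagonal_mul_diagonal]; rfl
      _ = U * Matrix.diagonal v * (Uᴴ * U) * Matrix.diagonal w * Uᴴ := by
          rw [this]; simp only [Matrix.mul_assoc, Matrix.one_mul]
      _ = _ := by simp only [Matrix.mul_assoc]
  map_add' v w := by
    have : Matrix.diagonal (v + w) = Matrix.diagonal v + Matrix.diagonal w := by
      rw [Matrix.diagonal_add]; rfl
    rw [this, Matrix.mul_add, Matrix.add_mul]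
  commutes' c := by
    have := Matrix.mem_unitaryGroup_iff.1 hU
    rw [Matrix.star_eq_conjTranspose] at this
    have h2 : Matrix.diagonal (algebraMap ℝ (ι → ℂ) c) = (c : ℂ) • (1 : Matrix ι ι ℂ) := by
      ext i j
      by_cases h : i = j
      · subst h; simp
      · simp [h]
    rw [h2]
    simp only [Matrix.mul_smul, Matrix.mul_one, Matrix.smul_mul, this]
    ext i j
    by_cases h : i = j
    · subst h; simp [Matrix.algebraMap_matrix_apply]
    · simp [Matrix.algebraMap_matrix_apply, h]
  map_star' v := by
    have : Matrix.diagonal (star v) = (Matrix.diagonal v)ᴴ := by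
      rw [Matrix.diagonal_conjTranspose]
    rw [this, Matrix.star_eq_conjTranspose]
    simp [Matrix.conjTranspose_mul, Matrix.mul_assoc]

end HelperMat

section HelperMono
open Matrix
open scoped Matrix.Norms.L2Operator MatrixOrder

variable {ι : Type*} [Fintype ι] [DecidableEq ι]

lemma exists_poly_eq_on (S : Finset ℝ) (f : ℝ → ℝ) :
    ∃ q : Polynomial ℝ, ∀ x ∈ S, q.eval x = f x :=
  ⟨Lagrange.interpolate S id f, fun x hx => by
    have := Lagrange.eval_interpolate_at_node (v := id) f (Function.injective_id.injOn) hx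
    simpa using this⟩

lemma specM_isHermitian (U : Matrix ι ι ℂ) (l : ι → ℝ) : (specM U l).IsHermitian := by
  unfold specM Matrix.IsHermitian
  simp only [Matrix.conjTranspose_mul, Matrix.conjTranspose_conjTranspose,
    Matrix.diagonal_conjTranspose, Matrix.mul_assoc]
  congr 3
  ext i
  simp

lemma specM_cfc (U : Matrix ι ι ℂ) (hU : U ∈ Matrix.unitaryGroup ι ℂ) (l : ι → ℝ)
    (f : ℝ → ℝ) : cfc f (specM U l) = specM U (fun i => f (l i)) := by
  have hfin : (spectrum ℝ (specM U l)).Finite := Matrix.finite_real_spectrum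
  obtain ⟨q, hq⟩ := exists_poly_eq_on (hfin.toFinset ∪ Finset.univ.image l) f
  have hsa : IsSelfAdjoint (specM U l) := specM_isHermitian U l
  have h1 : cfc f (specM U l) = cfc q.eval (specM U l) := by
    refine cfc_congr fun x hx => (hq x ?_).symm
    simp [hx]
  have h2 : specM U l = specHom U hU (fun i => (l i : ℂ)) := rfl
  rw [h1, cfc_polynomial q (specM U l), h2, Polynomial.aeval_algHom_apply (specHom U hU)]
  show U * Matrix.diagonal _ * Uᴴ = U * Matrix.diagonal _ * Uᴴ
  congr 3
  ext i
  have := Polynomial.aeval_algHom_apply (Pi.evalAlgHom ℝ (fun _ : ι => ℂ) i)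
    (fun i => (l i : ℂ)) q
  simp only [Pi.evalAlgHom_apply] at this
  show _ = ((f (l i) : ℝ) : ℂ)
  rw [← this, ← hq (l i) (by simp)]
  have := Polynomial.aeval_algebraMap_apply_eq_algebraMap_eval (A := ℂ) (l i) q
  simpa using this

lemma specM_posSemidef (U : Matrix ι ι ℂ) (l : ι → ℝ) (hl : ∀ i, 0 ≤ l i) :
    (specM U l).PosSemidef := by
  unfold specM
  refine Matrix.PosSemidef.mul_mul_conjTranspose_same ?_ U
  rw [Matrix.posSemidef_diagonal_iff]
  intro i
  exact_mod_cast hl i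

lemma specM_rpow (U : Matrix ι ι ℂ) (hU : U ∈ Matrix.unitaryGroup ι ℂ)
    (l : ι → ℝ) (hl : ∀ i, 0 ≤ l i) (s : ℝ) :
    (specM U l) ^ s = specM U (fun i => l i ^ s) := by
  have h0 : 0 ≤ specM U l := Matrix.nonneg_iff_posSemidef.2 (specM_posSemidef U l hl)
  rw [CFC.rpow_eq_cfc_real h0, specM_cfc U hU]

lemma specM_rpow_mono (U V : Matrix ι ι ℂ) (hU : U ∈ Matrix.unitaryGroup ι ℂ)
    (hV : V ∈ Matrix.unitaryGroup ι ℂ) (l m : ι → ℝ)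
    (hl : ∀ i, 0 ≤ l i) (hm : ∀ i, 0 ≤ m i)
    (h : (specM V m - specM U l).PosSemidef) (s : ℝ) (hs : s ∈ Set.Icc (0 : ℝ) 1) :
    (specM V (fun i => m i ^ s) - specM U (fun i => l i ^ s)).PosSemidef := by
  have h1 : specM U l ≤ specM V m := h
  have h2 := CFC.rpow_le_rpow hs h1
  rw [specM_rpow U hU l hl, specM_rpow V hV m hm] at h2
  exact h2

end HelperMono

section HelperAud
open Matrix

variable {ι : Type*} [Fintype ι] [DecidableEq ι]

lemma herm_eq_specM (A : Matrix ι ι ℂ) (hA : A.IsHermitian) :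
    A = specM (hA.eigenvectorUnitary : Matrix ι ι ℂ) hA.eigenvalues := by
  have h := hA.spectral_theorem
  rw [Unitary.conjStarAlgAut_apply] at h
  exact h

lemma specM_mul (U : Matrix ι ι ℂ) (hU : U ∈ Matrix.unitaryGroup ι ℂ) (l m : ι → ℝ) :
    specM U l * specM U m = specM U (fun i => l i * m i) := by
  have h : specM U l * specM U m = specHom U hU ((fun i => (l i : ℂ)) * (fun i => (m i : ℂ))) := by
    rw [map_mul]; rfl
  rw [h]
  show U * Matrix.diagonal _ * Uᴴ = U * Matrix.diagonal _ * Uᴴ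
  congr 3
  ext i
  simp

lemma specM_sub (U : Matrix ι ι ℂ) (l m : ι → ℝ) :
    specM U l - specM U m = specM U (fun i => l i - m i) := by
  unfold specM
  rw [← Matrix.sub_mul, ← Matrix.mul_sub, Matrix.diagonal_sub]
  congr 3
  ext i
  simp

lemma specM_one (U : Matrix ι ι ℂ) (hU : U ∈ Matrix.unitaryGroup ι ℂ) :
    specM U (fun _ => 1) = 1 := by
  have h := map_one (specHom U hU)
  rw [← h]
  show U * Matrix.diagonal _ * Uᴴ = U * Matrix.diagonal _ * Uᴴ
  congr 3

lemma trace_mul_nonneg' (A B : Matrix ι ι ℂ) (hA : A.PosSemidef) (hB : B.PosSemidef) :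
    0 ≤ (A * B).trace.re := by
  rw [herm_eq_specM A hA.1, herm_eq_specM B hB.1, specM_trace_mul]
  refine Finset.sum_nonneg fun i _ => Finset.sum_nonneg fun j _ => ?_
  exact mul_nonneg (mul_nonneg (hA.eigenvalues_nonneg i) (hB.eigenvalues_nonneg j))
    (Complex.normSq_nonneg _)

lemma rpow_mul_rpow_one_sub {x : ℝ} (hx : 0 ≤ x) (s : ℝ) : x ^ s * x ^ (1 - s) = x := by
  rw [← Real.rpow_add' hx (by norm_num)]
  norm_num

lemma audenaert (U V : Matrix ι ι ℂ) (hU : U ∈ Matrix.unitaryGroup ι ℂ)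
    (hV : V ∈ Matrix.unitaryGroup ι ℂ) (l m : ι → ℝ)
    (hl : ∀ i, 0 ≤ l i) (hm : ∀ i, 0 ≤ m i) (s : ℝ) (hs : s ∈ Set.Icc (0 : ℝ) 1) :
    ∃ T : Matrix ι ι ℂ, T.PosSemidef ∧ (1 - T).PosSemidef ∧
      (specM U l * (1 - T)).trace.re + (specM V m * T).trace.re ≤
        ∑ i, ∑ j, l i ^ (1 - s) * m j ^ s * Complex.normSq ((Uᴴ * V) i j) := by
  have hH : (specM U l - specM V m).IsHermitian :=
    (specM_isHermitian U l).sub (specM_isHermitian V m)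
  obtain ⟨W, hW, e, he⟩ : ∃ W ∈ Matrix.unitaryGroup ι ℂ, ∃ e : ι → ℝ,
      specM U l - specM V m = specM W e :=
    ⟨_, (hH.eigenvectorUnitary).2, _, herm_eq_specM _ hH⟩
  set P := specM W (fun i => if 0 < e i then 1 else 0) with hP
  set Hp := specM W (fun i => max (e i) 0) with hHp
  have hPp : P.PosSemidef := specM_posSemidef _ _ fun i => by split_ifs <;> norm_num
  have hPq : (1 - P).PosSemidef := by
    rw [hP, ← specM_one W hW, specM_sub]
    exact specM_posSemidef _ _ fun i => by split_ifs <;> norm_num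
  have hHP : specM W e * P = Hp := by
    rw [hP, hHp, specM_mul W hW]
    congr 1
    ext i
    split_ifs with h
    · simp [h.le]
    · simp [not_lt.1 h]
  have hHp0 : Hp.PosSemidef := specM_posSemidef _ _ fun i => le_max_right _ _
  have hHpH : (Hp - specM W e).PosSemidef := by
    rw [hHp, specM_sub]
    exact specM_posSemidef _ _ fun i => by simp
  -- the dominating matrix
  have hC : (specM V m + Hp).PosSemidef := (specM_posSemidef V m hm).add hHp0
  obtain ⟨Y, hY, c, hc, hCe⟩ : ∃ Y ∈ Matrix.unitaryGroup ι ℂ, ∃ c : ι → ℝ, (∀ i, 0 ≤ c i) ∧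
      specM V m + Hp = specM Y c :=
    ⟨_, (hC.1.eigenvectorUnitary).2, _, hC.eigenvalues_nonneg, herm_eq_specM _ hC.1⟩
  have hAC : (specM Y c - specM U l).PosSemidef := by
    rw [← hCe]
    have : specM V m + Hp - specM U l = Hp - specM W e := by rw [← he]; abel
    rwa [this]
  have hBC : (specM Y c - specM V m).PosSemidef := by
    rw [← hCe]; simpa using hHp0
  have hs' : 1 - s ∈ Set.Icc (0 : ℝ) 1 := ⟨by linarith [hs.2], by linarith [hs.1]⟩
  have m1 := specM_rpow_mono U Y hU hY l c hl hc hAC s hs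
  have m2 := specM_rpow_mono U Y hU hY l c hl hc hAC (1 - s) hs'
  have m3 := specM_rpow_mono V Y hV hY m c hm hc hBC s hs
  have m4 := specM_rpow_mono V Y hV hY m c hm hc hBC (1 - s) hs'
  have pw : ∀ (X : Matrix ι ι ℂ) (_ : X ∈ Matrix.unitaryGroup ι ℂ) (x : ι → ℝ) (_ : ∀ i, 0 ≤ x i),
      specM X (fun i => x i ^ s) * specM X (fun i => x i ^ (1 - s)) = specM X x := by
    intro X hX x hx
    rw [specM_mul X hX]
    congr 1
    ext i
    exact rpow_mul_rpow_one_sub (hx i) s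
  have t1 := trace_mul_nonneg' _ _ m1 (specM_posSemidef U _ fun i => Real.rpow_nonneg (hl i) (1 - s))
  have t2 := trace_mul_nonneg' _ _ m3 m2
  have t3 := trace_mul_nonneg' _ _ (specM_posSemidef V _ fun i => Real.rpow_nonneg (hm i) s) m4
  refine ⟨P, hPp, hPq, ?_⟩
  rw [← specM_trace_mul U V (fun i => l i ^ (1 - s)) (fun i => m i ^ s),
    Matrix.trace_mul_comm (specM U fun i => l i ^ (1 - s))]
  have e1 : specM U l * (1 - P) = specM U l - specM U l * P := by
    rw [Matrix.mul_sub, Matrix.mul_one]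
  have e2 : Hp = specM U l * P - specM V m * P := by
    rw [← hHP, ← he, Matrix.sub_mul]
  simp only [Matrix.sub_mul, Matrix.mul_sub, pw U hU l hl, pw V hV m hm, pw Y hY c hc,
    Matrix.trace_sub, Complex.sub_re] at t1 t2 t3
  rw [← hCe, Matrix.trace_add, Complex.add_re, e2, Matrix.trace_sub, Complex.sub_re] at t2
  rw [e1, Matrix.trace_sub, Complex.sub_re]
  linarith

/-- Nussbaum–Szkoła type lower bound. -/
lemma nussbaum (U V : Matrix ι ι ℂ) (hU : U ∈ Matrix.unitaryGroup ι ℂ)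
    (hV : V ∈ Matrix.unitaryGroup ι ℂ) (l m : ι → ℝ)
    (hl : ∀ i, 0 ≤ l i) (hm : ∀ i, 0 ≤ m i) (T : Matrix ι ι ℂ) (hT : T.PosSemidef)
    (hT1 : (1 - T).PosSemidef) (a : ℝ) (ha : 0 ≤ a) :
    ∑ i, ∑ j, min (l i) (a * m j) * Complex.normSq ((Uᴴ * V) i j) ≤
      2 * ((specM U l * (1 - T)).trace.re + a * (specM V m * T).trace.re) := by
  have hTT : (T * (1 - T)).PosSemidef := by
    obtain ⟨W, hW, e, he⟩ : ∃ W ∈ Matrix.unitaryGroup ι ℂ, ∃ e : ι → ℝ, T = specM W e :=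
      ⟨_, (hT.1.eigenvectorUnitary).2, _, herm_eq_specM _ hT.1⟩
    have h1 : T * (1 - T) = T * (1 - T) * T + (1 - T) * T * (1 - T) := by noncomm_ring
    rw [h1]
    have h2 := hT1.mul_mul_conjTranspose_same T
    have h3 := hT.mul_mul_conjTranspose_same (1 - T)
    rw [hT.1.eq] at h2
    rw [hT1.1.eq] at h3
    exact h2.add h3
  have k1 := trace_mul_nonneg' _ _ (specM_posSemidef U l hl) hTT
  have k2 := trace_mul_nonneg' _ _ (specM_posSemidef V m hm) hTT
  have hUU := Matrix.mem_unitaryGroup_iff.1 hU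
  have hVV := Matrix.mem_unitaryGroup_iff.1 hV
  rw [Matrix.star_eq_conjTranspose] at hUU hVV
  have q1 : (specM U l * ((1 - T) * (1 - T))).trace.re
      = ∑ i, ∑ j, l i * Complex.normSq ((Uᴴ * (1 - T) * V) i j) := by
    have : specM U l * ((1 - T) * (1 - T)) = specM U l * specM ((1 - T) * V) (fun _ => 1) := by
      congr 1
      unfold specM
      simp only [Complex.ofReal_one, Matrix.diagonal_one, Matrix.mul_one,
        Matrix.conjTranspose_mul, hT1.1.eq, Matrix.mul_assoc]
      rw [← Matrix.mul_assoc V, hVV, Matrix.one_mul]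
    rw [this, specM_trace_mul]
    simp [Matrix.mul_assoc]
  have q2 : (specM V m * (T * T)).trace.re
      = ∑ i, ∑ j, m j * Complex.normSq ((Uᴴ * T * V) i j) := by
    have : T * T = specM (T * U) (fun _ => 1) := by
      unfold specM
      simp only [Complex.ofReal_one, Matrix.diagonal_one, Matrix.mul_one,
        Matrix.conjTranspose_mul, hT.1.eq, Matrix.mul_assoc]
      rw [← Matrix.mul_assoc U, hUU, Matrix.one_mul]
    rw [Matrix.trace_mul_comm, this, specM_trace_mul]
    simp [Matrix.conjTranspose_mul, hT.1.eq]
  have r1 : specM U l * (1 - T) = specM U l * ((1 - T) * (1 - T)) + specM U l * (T * (1 - T)) := by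
    noncomm_ring
  have r2 : specM V m * T = specM V m * (T * T) + specM V m * (T * (1 - T)) := by
    noncomm_ring
  rw [r1, r2, Matrix.trace_add, Matrix.trace_add, Complex.add_re, Complex.add_re, q1, q2]
  have main : ∑ i, ∑ j, min (l i) (a * m j) * Complex.normSq ((Uᴴ * V) i j) ≤
      2 * (∑ i, ∑ j, l i * Complex.normSq ((Uᴴ * (1 - T) * V) i j)
        + a * ∑ i, ∑ j, m j * Complex.normSq ((Uᴴ * T * V) i j)) := by
    simp only [Finset.mul_sum, ← Finset.sum_add_distrib]
    refine Finset.sum_le_sum fun i _ => Finset.sum_le_sum fun j _ => ?_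
    have hK : (Uᴴ * V) i j = (Uᴴ * (1 - T) * V) i j + (Uᴴ * T * V) i j := by
      have hK' : Uᴴ * V = Uᴴ * (1 - T) * V + Uᴴ * T * V := by
        rw [← Matrix.add_mul, ← Matrix.mul_add, sub_add_cancel, Matrix.mul_one]
      rw [← Matrix.add_apply, ← hK']
    rw [hK]
    generalize (Uᴴ * (1 - T) * V) i j = x
    generalize (Uᴴ * T * V) i j = y
    have hxy : Complex.normSq (x + y) ≤ 2 * (Complex.normSq x + Complex.normSq y) := by
      simp only [Complex.normSq_apply, Complex.add_re, Complex.add_im]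
      nlinarith [sq_nonneg (x.re - y.re), sq_nonneg (x.im - y.im)]
    have hmin : 0 ≤ min (l i) (a * m j) := le_min (hl i) (mul_nonneg ha (hm j))
    have b1 := mul_le_mul_of_nonneg_left hxy hmin
    have b2 := mul_le_mul_of_nonneg_right (min_le_left (l i) (a * m j)) (Complex.normSq_nonneg x)
    have b3 := mul_le_mul_of_nonneg_right (min_le_right (l i) (a * m j)) (Complex.normSq_nonneg y)
    linarith
  have := mul_nonneg ha k2
  linarith

end HelperAud

section HelperTensor
open Matrix

variable {d : ℕ}

lemma tensorPow_mul (A B : Matrix (Fin d) (Fin d) ℂ) (n : ℕ) :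
    tensorPow (A * B) n = tensorPow A n * tensorPow B n := by
  ext v w
  simp only [tensorPow, Matrix.mul_apply]
  rw [Finset.prod_univ_sum]
  simp [Finset.prod_mul_distrib]

lemma tensorPow_conjTranspose (A : Matrix (Fin d) (Fin d) ℂ) (n : ℕ) :
    tensorPow Aᴴ n = (tensorPow A n)ᴴ := by
  ext v w
  simp [tensorPow, Matrix.conjTranspose_apply]

lemma tensorPow_diagonal (l : Fin d → ℂ) (n : ℕ) :
    tensorPow (Matrix.diagonal l) n = Matrix.diagonal (fun v : Fin n → Fin d => ∏ t, l (v t)) := by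
  ext v w
  by_cases h : v = w
  · subst h; simp [tensorPow]
  · rw [Matrix.diagonal_apply_ne _ h]
    obtain ⟨t, ht⟩ := Function.ne_iff.1 h
    exact Finset.prod_eq_zero (Finset.mem_univ t) (Matrix.diagonal_apply_ne _ ht)

lemma tensorPow_one (n : ℕ) : tensorPow (1 : Matrix (Fin d) (Fin d) ℂ) n = 1 := by
  rw [← Matrix.diagonal_one, tensorPow_diagonal]
  simp

lemma tensorPow_unitary (U : Matrix (Fin d) (Fin d) ℂ) (hU : U ∈ Matrix.unitaryGroup (Fin d) ℂ)
    (n : ℕ) : tensorPow U n ∈ Matrix.unitaryGroup (Fin n → Fin d) ℂ := by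
  rw [Matrix.mem_unitaryGroup_iff, Matrix.star_eq_conjTranspose] at *
  rw [← tensorPow_conjTranspose, ← tensorPow_mul, hU, tensorPow_one]

lemma tensorPow_specM (U : Matrix (Fin d) (Fin d) ℂ) (l : Fin d → ℝ) (n : ℕ) :
    tensorPow (specM U l) n = specM (tensorPow U n) (fun v => ∏ t, l (v t)) := by
  unfold specM
  rw [tensorPow_mul, tensorPow_mul, tensorPow_diagonal, tensorPow_conjTranspose]
  simp

lemma normSq_tensorPow (K : Matrix (Fin d) (Fin d) ℂ) (n : ℕ) (v w : Fin n → Fin d) :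
    Complex.normSq (tensorPow K n v w) = ∏ t, Complex.normSq (K (v t) (w t)) := by
  simp [tensorPow]

lemma sum_pairs_eq (n : ℕ) (F : (Fin n → Fin d × Fin d) → ℝ) :
    ∑ v : Fin n → Fin d, ∑ w : Fin n → Fin d, F (fun t => (v t, w t))
      = ∑ x : Fin n → Fin d × Fin d, F x := by
  rw [← Fintype.sum_prod_type' (f := fun (v w : Fin n → Fin d) => F (fun t => (v t, w t)))]
  exact (Equiv.sum_comp (Equiv.arrowProdEquivProdArrow (Fin n) (fun _ => Fin d) (fun _ => Fin d))
    (fun p => F (fun t => (p.1 t, p.2 t)))).symm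

lemma sum_pi_prod {Ω : Type*} [Fintype Ω] [DecidableEq Ω] (n : ℕ) (p : Ω → ℝ) :
    ∑ x : Fin n → Ω, ∏ t, p (x t) = (∑ o, p o) ^ n := by
  have h := Finset.prod_univ_sum (fun _ : Fin n => (Finset.univ : Finset Ω)) (fun _ o => p o)
  simp only [Fintype.piFinset_univ, Finset.prod_const, Finset.card_univ, Fintype.card_fin] at h
  exact h.symm

lemma sum_pi_succ {Ω : Type*} [Fintype Ω] [DecidableEq Ω] (n : ℕ) (F : (Fin (n + 1) → Ω) → ℝ) :
    ∑ x, F x = ∑ o : Ω, ∑ x : Fin n → Ω, F (Fin.cons o x) := by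
  rw [← Fintype.sum_prod_type' (f := fun (o : Ω) (x : Fin n → Ω) => F (Fin.cons o x))]
  exact (Equiv.sum_comp (Fin.consEquiv (fun _ => Ω)) F).symm

/-- moments of sums of centred i.i.d. variables -/
lemma moments {Ω : Type*} [Fintype Ω] [DecidableEq Ω] (p Y : Ω → ℝ) (hp : ∑ o, p o = 1)
    (hY : ∑ o, p o * Y o = 0) (n : ℕ) :
    ∑ x : Fin n → Ω, (∏ t, p (x t)) * (∑ t, Y (x t)) = 0 ∧
    ∑ x : Fin n → Ω, (∏ t, p (x t)) * (∑ t, Y (x t)) ^ 2 = n * ∑ o, p o * Y o ^ 2 := by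
  induction n with
  | zero => simp
  | succ n ih =>
    have h0 := sum_pi_prod n p
    rw [hp, one_pow] at h0
    constructor
    · rw [sum_pi_succ]
      simp only [Fin.prod_univ_succ, Fin.sum_univ_succ, Fin.cons_zero, Fin.cons_succ]
      have : ∀ o : Ω, ∑ x : Fin n → Ω, (p o * ∏ t, p (x t)) * (Y o + ∑ t, Y (x t))
          = p o * Y o := by
        intro o
        calc _ = p o * Y o * (∑ x : Fin n → Ω, ∏ t, p (x t))
              + p o * (∑ x : Fin n → Ω, (∏ t, p (x t)) * (∑ t, Y (x t))) := by
              rw [Finset.mul_sum, Finset.mul_sum, ← Finset.sum_add_distrib]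
              exact Finset.sum_congr rfl fun x _ => by ring
          _ = _ := by rw [h0, ih.1]; ring
      simp only [this, hY]
    · rw [sum_pi_succ]
      simp only [Fin.prod_univ_succ, Fin.sum_univ_succ, Fin.cons_zero, Fin.cons_succ]
      have : ∀ o : Ω, ∑ x : Fin n → Ω, (p o * ∏ t, p (x t)) * (Y o + ∑ t, Y (x t)) ^ 2
          = p o * Y o ^ 2 + p o * (n * ∑ o, p o * Y o ^ 2) := by
        intro o
        calc _ = p o * Y o ^ 2 * (∑ x : Fin n → Ω, ∏ t, p (x t))
              + 2 * p o * Y o * (∑ x : Fin n → Ω, (∏ t, p (x t)) * (∑ t, Y (x t)))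
              + p o * (∑ x : Fin n → Ω, (∏ t, p (x t)) * (∑ t, Y (x t)) ^ 2) := by
              rw [Finset.mul_sum, Finset.mul_sum, Finset.mul_sum, ← Finset.sum_add_distrib,
                ← Finset.sum_add_distrib]
              exact Finset.sum_congr rfl fun x _ => by ring
          _ = _ := by rw [h0, ih.1, ih.2]; ring
      simp only [this, Finset.sum_add_distrib, ← Finset.sum_mul, hp]
      push_cast
      ring

/-- Lower bound for expectations of `exp(-|S|)`. -/
lemma exp_abs_lower {Ω : Type*} [Fintype Ω] [DecidableEq Ω] (p Y : Ω → ℝ) (hp0 : ∀ o, 0 ≤ p o)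
    (hp : ∑ o, p o = 1) (hY : ∑ o, p o * Y o = 0) (n : ℕ) (hn : 0 < n) (δ : ℝ) (hδ : 0 < δ) :
    Real.exp (-(δ * n)) * (1 - (∑ o, p o * Y o ^ 2) / (δ ^ 2 * n)) ≤
      ∑ x : Fin n → Ω, (∏ t, p (x t)) * Real.exp (-|∑ t, Y (x t)|) := by
  have hn' : (0 : ℝ) < n := by exact_mod_cast hn
  have key : ∀ S : ℝ, Real.exp (-(δ * n)) * (1 - S ^ 2 / (δ * n) ^ 2) ≤ Real.exp (-|S|) := by
    intro S
    have hdn : 0 < δ * n := mul_pos hδ hn'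
    by_cases h : |S| ≤ δ * n
    · calc _ ≤ Real.exp (-(δ * n)) * 1 := by
            gcongr
            have : 0 ≤ S ^ 2 / (δ * n) ^ 2 := by positivity
            linarith
        _ ≤ _ := by rw [mul_one]; gcongr
    · have h1 : 1 - S ^ 2 / (δ * n) ^ 2 ≤ 0 := by
        have : (δ * n) ^ 2 ≤ S ^ 2 := by
          rw [← sq_abs S]; gcongr; exact (not_le.1 h).le
        have : 1 ≤ S ^ 2 / (δ * n) ^ 2 := by
          rw [one_le_div (by positivity)]; exact this
        linarith
      exact (mul_nonpos_of_nonneg_of_nonpos (Real.exp_nonneg _) h1).trans (Real.exp_nonneg _)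
  calc _ = ∑ x : Fin n → Ω, (∏ t, p (x t)) *
        (Real.exp (-(δ * n)) * (1 - (∑ t, Y (x t)) ^ 2 / (δ * n) ^ 2)) := by
        have e : ∀ x : Fin n → Ω, (∏ t, p (x t)) *
          (Real.exp (-(δ * n)) * (1 - (∑ t, Y (x t)) ^ 2 / (δ * n) ^ 2)) =
          Real.exp (-(δ * n)) * (∏ t, p (x t))
          - Real.exp (-(δ * n)) / (δ * n) ^ 2 * ((∏ t, p (x t)) * (∑ t, Y (x t)) ^ 2) := by
          intro x; ring
        simp only [e, Finset.sum_sub_distrib, ← Finset.mul_sum, (moments p Y hp hY n).2,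
          sum_pi_prod, hp, one_pow]
        field_simp
    _ ≤ _ := Finset.sum_le_sum fun x _ =>
        mul_le_mul_of_nonneg_left (key _) (Finset.prod_nonneg fun t _ => hp0 _)

end HelperTensor

section HelperClassical

variable {Ω : Type*} [Fintype Ω] [DecidableEq Ω]

/-- classical partition function -/
def cZ (w a b : Ω → ℝ) (s : ℝ) : ℝ := ∑ o, w o * Real.exp ((1 - s) * a o + s * b o)

/-- logarithmic derivative of the partition function -/
def cm (w a b : Ω → ℝ) (s : ℝ) : ℝ :=
  (∑ o, w o * Real.exp ((1 - s) * a o + s * b o) * (b o - a o)) / cZ w a b s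

lemma cZ_continuous (w a b : Ω → ℝ) : Continuous (cZ w a b) := by
  unfold cZ; fun_prop

lemma cZ_pos (w a b : Ω → ℝ) (hw : ∀ o, 0 ≤ w o) (h0 : cZ w a b 0 = 1) (s : ℝ) :
    0 < cZ w a b s := by
  have : ∃ o, w o ≠ 0 := by
    by_contra! h
    simp [cZ, h] at h0
  obtain ⟨o, ho⟩ := this
  refine Finset.sum_pos' (fun o _ => mul_nonneg (hw o) (Real.exp_nonneg _))
    ⟨o, Finset.mem_univ o, mul_pos (lt_of_le_of_ne (hw o) ho.symm) (Real.exp_pos _)⟩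

lemma cm_continuous (w a b : Ω → ℝ) (hw : ∀ o, 0 ≤ w o) (h0 : cZ w a b 0 = 1) :
    Continuous (cm w a b) := by
  unfold cm
  refine Continuous.div (by fun_prop) (cZ_continuous w a b) fun s => (cZ_pos w a b hw h0 s).ne'

lemma classical_lower (w a b : Ω → ℝ) (hw : ∀ o, 0 ≤ w o) (s : ℝ) (hs : s ∈ Set.Icc (0 : ℝ) 1)
    (hZ : 0 < cZ w a b s) :
    ∃ Vr : ℝ, 0 ≤ Vr ∧ ∀ (n : ℕ) (δ : ℝ), 0 < n → 0 < δ →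
    Real.exp (n * (Real.log (cZ w a b s) - s * cm w a b s)) *
      (Real.exp (-(δ * n)) * (1 - Vr / (δ ^ 2 * n))) ≤
    ∑ x : Fin n → Ω, min (∏ t, Real.exp (a (x t)))
      (Real.exp (-(n * cm w a b s)) * ∏ t, Real.exp (b (x t))) * ∏ t, w (x t) := by
  set Z := cZ w a b s with hZdef
  set m := cm w a b s with hm
  set p : Ω → ℝ := fun o => w o * Real.exp ((1 - s) * a o + s * b o) / Z with hpdef
  set Y : Ω → ℝ := fun o => b o - a o - m with hYdef
  have hp0 : ∀ o, 0 ≤ p o := fun o =>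
    div_nonneg (mul_nonneg (hw o) (Real.exp_nonneg _)) hZ.le
  have hp : ∑ o, p o = 1 := by
    rw [hpdef, ← Finset.sum_div]
    exact div_self hZ.ne'
  have hY : ∑ o, p o * Y o = 0 := by
    have : ∀ o, p o * Y o = w o * Real.exp ((1 - s) * a o + s * b o) * (b o - a o) / Z
        - p o * m := by
      intro o; simp only [hpdef, hYdef]; ring
    simp only [this, Finset.sum_sub_distrib, ← Finset.sum_mul, hp, ← Finset.sum_div]
    rw [hm]; unfold cm; rw [← hZdef]; ring
  refine ⟨∑ o, p o * Y o ^ 2, Finset.sum_nonneg fun o _ => mul_nonneg (hp0 o) (sq_nonneg _), ?_⟩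
  intro n δ hn hδ
  refine (mul_le_mul_of_nonneg_left (exp_abs_lower p Y hp0 hp hY n hn δ hδ)
    (Real.exp_nonneg _)).trans ?_
  rw [Finset.mul_sum]
  refine Finset.sum_le_sum fun x _ => ?_
  set S := ∑ t, Y (x t) with hS
  have hSsum : S = ∑ t, b (x t) - ∑ t, a (x t) - n * m := by
    simp [hS, hYdef, Finset.sum_sub_distrib]
  have hP : ∏ t, p (x t) = (∏ t, w (x t)) *
      Real.exp ((1 - s) * ∑ t, a (x t) + s * ∑ t, b (x t)) / Z ^ n := by
    simp only [hpdef, Finset.prod_div_distrib, Finset.prod_mul_distrib, ← Real.exp_sum,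
      Finset.sum_add_distrib, ← Finset.mul_sum]
    simp
  have hZn : Real.exp (n * (Real.log Z - s * m)) = Z ^ n * Real.exp (-(n * (s * m))) := by
    rw [mul_sub, sub_eq_add_neg, Real.exp_add, mul_comm (n : ℝ) (Real.log Z), ← Real.rpow_def_of_pos hZ,
      Real.rpow_natCast]
  have hW : 0 ≤ ∏ t, w (x t) := Finset.prod_nonneg fun t _ => hw _
  have hZn0 : Z ^ n ≠ 0 := (pow_pos hZ n).ne'
  have lhs : Real.exp (n * (Real.log Z - s * m)) * ((∏ t, p (x t)) * Real.exp (-|S|))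
      = Real.exp (-(n * (s * m)) + ((1 - s) * ∑ t, a (x t) + s * ∑ t, b (x t)) + -|S|)
        * ∏ t, w (x t) := by
    rw [hZn, hP]
    simp only [Real.exp_add]
    field_simp
  rw [lhs, ← Real.exp_sum, ← Real.exp_sum, ← Real.exp_add]
  refine mul_le_mul_of_nonneg_right (le_min ?_ ?_) hW
  · rw [Real.exp_le_exp]
    have : s * S ≤ |S| := by
      have h1 := le_abs_self S
      have h2 := abs_nonneg S
      nlinarith [hs.1, hs.2]
    have e : ∑ t, b (x t) = S + ∑ t, a (x t) + n * m := by rw [hSsum]; ring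
    rw [e]; nlinarith
  · rw [Real.exp_le_exp]
    have : -((1 - s) * S) ≤ |S| := by
      have h1 := neg_abs_le S
      have h2 := abs_nonneg S
      nlinarith [hs.1, hs.2]
    have e : ∑ t, a (x t) = ∑ t, b (x t) - S - n * m := by rw [hSsum]; ring
    rw [e]; nlinarith

lemma tendsto_log_rate (f : ℕ → ℝ) (k K c : ℝ) (hk : 0 < k)
    (h1 : ∀ᶠ n : ℕ in atTop, k * Real.exp (-(n * c)) ≤ f n)
    (h2 : ∀ᶠ n : ℕ in atTop, f n ≤ K * Real.exp (-(n * c))) :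
    Tendsto (fun n : ℕ => (1 / (n : ℝ)) * Real.log (f n)) atTop (nhds (-c)) := by
  have hlim : ∀ x : ℝ, Tendsto (fun n : ℕ => Real.log x / (n : ℝ) - c) atTop (nhds (-c)) := by
    intro x
    have := (tendsto_const_div_atTop_nhds_zero_nat (Real.log x)).sub_const c
    simpa using this
  refine tendsto_of_tendsto_of_tendsto_of_le_of_le' (hlim k) (hlim K) ?_ ?_
  · filter_upwards [h1, eventually_gt_atTop 0] with n hn hn0
    have hn' : (0 : ℝ) < n := by exact_mod_cast hn0
    have := Real.log_le_log (by positivity) hn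
    rw [Real.log_mul hk.ne' (Real.exp_pos _).ne', Real.log_exp] at this
    rw [one_div, inv_mul_eq_div, le_div_iff₀ hn', sub_mul, div_mul_cancel₀ _ hn'.ne']
    linarith
  · filter_upwards [h1, h2, eventually_gt_atTop 0] with n hn hn2 hn0
    have hn' : (0 : ℝ) < n := by exact_mod_cast hn0
    have hf : 0 < f n := lt_of_lt_of_le (by positivity) hn
    have hK : 0 < K := by
      have := lt_of_lt_of_le hf hn2
      exact pos_of_mul_pos_left this (Real.exp_nonneg _)
    have := Real.log_le_log hf hn2
    rw [Real.log_mul hK.ne' (Real.exp_pos _).ne', Real.log_exp] at this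
    rw [one_div, inv_mul_eq_div, div_le_iff₀ hn', sub_mul, div_mul_cancel₀ _ hn'.ne']
    linarith

lemma converse_rate (α β : ℕ → ℝ) (hβ0 : ∀ n, 0 ≤ β n) (hβ1 : ∀ n, β n ≤ 1)
    (φ m s Vr r c : ℝ)
    (hmain : ∀ (n : ℕ) (δ : ℝ), 0 < n → 0 < δ →
      Real.exp (n * (φ - s * m)) * (Real.exp (-(δ * n)) * (1 - Vr / (δ ^ 2 * n))) ≤
        2 * (α n + Real.exp (-(n * m)) * β n))
    (hr : 0 < r) (hlt : -φ - (1 - s) * m < r)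
    (hlim : limsup (fun n : ℕ => (1 / (n : ℝ)) * Real.log (β n)) atTop ≤ -r)
    (htend : Tendsto (fun n : ℕ => (1 / (n : ℝ)) * Real.log (α n)) atTop (nhds (-c))) :
    c ≤ s * m - φ := by
  refine le_of_forall_pos_le_add fun δ₀ hδ₀ => ?_
  -- choose parameters
  obtain ⟨δ, hδ, hδ1, hδ2, hδ3⟩ : ∃ δ : ℝ, 0 < δ ∧ δ ≤ δ₀ ∧ δ < r ∧
      2 * δ < r + φ + (1 - s) * m := by
    have hg : 0 < r + φ + (1 - s) * m := by linarith
    refine ⟨min δ₀ (min (r / 2) ((r + φ + (1 - s) * m) / 4)), by positivity, min_le_left _ _, ?_, ?_⟩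
    · have := (min_le_right δ₀ (min (r / 2) ((r + φ + (1 - s) * m) / 4))).trans (min_le_left _ _)
      linarith
    · have := (min_le_right δ₀ (min (r / 2) ((r + φ + (1 - s) * m) / 4))).trans (min_le_right _ _)
      linarith
  have hev : ∀ᶠ n : ℕ in atTop, (1 / (n : ℝ)) * Real.log (β n) < -r + δ := by
    refine eventually_lt_of_limsup_lt (lt_of_le_of_lt hlim (by linarith)) ?_
    refine isBoundedUnder_of ⟨0, fun n => ?_⟩
    exact mul_nonpos_of_nonneg_of_nonpos (by positivity) (Real.log_nonpos (hβ0 n) (hβ1 n))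
  set g := r + φ + (1 - s) * m - 2 * δ with hg
  have hg0 : 0 < g := by linarith
  have hV : ∀ᶠ n : ℕ in atTop, Vr / (δ ^ 2 * n) < 1 / 2 := by
    have : Tendsto (fun n : ℕ => Vr / δ ^ 2 / (n : ℝ)) atTop (nhds 0) :=
      tendsto_const_div_atTop_nhds_zero_nat _
    filter_upwards [this.eventually_lt_const (by norm_num : (0 : ℝ) < 1 / 2)] with n hn
    rwa [← div_div]
  have hE : ∀ᶠ n : ℕ in atTop, Real.exp (-(n * g)) < 1 / 8 := by
    have h1 : Tendsto (fun n : ℕ => (n : ℝ) * g) atTop atTop :=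
      tendsto_natCast_atTop_atTop.atTop_mul_const hg0
    exact (Real.tendsto_exp_neg_atTop_nhds_zero.comp h1).eventually_lt_const (by norm_num)
  have hlow : ∀ᶠ n : ℕ in atTop,
      Real.log (1 / 8) / (n : ℝ) - (s * m - φ + δ) ≤ (1 / (n : ℝ)) * Real.log (α n) := by
    filter_upwards [hev, hV, hE, eventually_gt_atTop 0] with n h1 h2 h3 h4
    have hn' : (0 : ℝ) < n := by exact_mod_cast h4
    have hβlt : β n ≤ Real.exp (-(n * (r - δ))) := by
      by_cases hb : β n = 0
      · rw [hb]; exact Real.exp_nonneg _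
      have hb' : 0 < β n := lt_of_le_of_ne (hβ0 n) (Ne.symm hb)
      rw [← Real.log_le_iff_le_exp hb']
      rw [one_div, inv_mul_eq_div, div_lt_iff₀ hn'] at h1
      linarith
    have h5 := hmain n δ h4 hδ
    set E := Real.exp (-(n * (s * m - φ + δ))) with hEdef
    have e1 : Real.exp (n * (φ - s * m)) * Real.exp (-(δ * n)) = E := by
      rw [hEdef, ← Real.exp_add]; congr 1; ring
    have hE0 : 0 < E := Real.exp_pos _
    have e2 : Real.exp (-(n * m)) * Real.exp (-(n * (r - δ))) = E * Real.exp (-(n * g)) := by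
      rw [hEdef, ← Real.exp_add, ← Real.exp_add]; congr 1; rw [hg]; ring
    have h6 : Real.exp (-(n * m)) * β n ≤ E * (1 / 8) := by
      calc _ ≤ Real.exp (-(n * m)) * Real.exp (-(n * (r - δ))) := by gcongr
        _ = E * Real.exp (-(n * g)) := e2
        _ ≤ _ := by gcongr
    rw [← mul_assoc, e1] at h5
    have h7 : E * (1 / 2) ≤ E * (1 - Vr / (δ ^ 2 * n)) := by
      gcongr; linarith
    have h8 : (1 / 8) * E ≤ α n := by linarith
    have := Real.log_le_log (by positivity) h8
    rw [Real.log_mul (by norm_num) hE0.ne', hEdef, Real.log_exp] at this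
    rw [one_div (n : ℝ), inv_mul_eq_div, le_div_iff₀ hn', sub_mul, div_mul_cancel₀ _ hn'.ne']
    linarith
  have hlim2 : Tendsto (fun n : ℕ => Real.log (1 / 8) / (n : ℝ) - (s * m - φ + δ)) atTop
      (nhds (-(s * m - φ + δ))) := by
    have := (tendsto_const_div_atTop_nhds_zero_nat (Real.log (1 / 8))).sub_const (s * m - φ + δ)
    simpa using this
  have := le_of_tendsto_of_tendsto hlim2 htend hlow
  linarith

/-- existence of the critical parameter -/
lemma exists_crit (φ m : ℝ → ℝ) (hφ : Continuous φ) (hm : Continuous m) (r : ℝ) (hr : 0 < r)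
    (h0 : r ≤ -φ 0 - m 0) (h1 : φ 1 = 0) :
    ∃ s ∈ Set.Ico (0 : ℝ) 1, ∀ c : ℝ,
      (∀ t ∈ Set.Icc (0 : ℝ) 1, -φ t - (1 - t) * m t < r → c ≤ t * m t - φ t) →
      c ≤ (-s * r - φ s) / (1 - s) := by
  set g : ℝ → ℝ := fun t => -φ t - (1 - t) * m t with hg
  have hgc : Continuous g := by fun_prop
  set A : Set ℝ := Set.Icc 0 1 ∩ g ⁻¹' (Set.Ici r) with hA
  have hAc : IsCompact A := isCompact_Icc.inter_right (isClosed_Ici.preimage hgc)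
  have hAn : A.Nonempty := ⟨0, ⟨by norm_num, by simp [hg]; linarith⟩⟩
  obtain ⟨s, hsA, hsmax⟩ := hAc.exists_isGreatest hAn
  have hs1 : s < 1 := by
    refine lt_of_le_of_ne hsA.1.2 fun h => ?_
    have : r ≤ g s := hsA.2
    rw [h] at this
    simp [hg, h1] at this
    linarith
  have hlt : ∀ t ∈ Set.Ioo s 1, g t < r := by
    intro t ht
    by_contra h
    have : t ∈ A := ⟨⟨hsA.1.1.trans ht.1.le, ht.2.le⟩, not_lt.1 h⟩
    exact absurd (hsmax this) (not_le.2 ht.1)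
  have hne : (nhdsWithin s (Set.Ioo s 1)).NeBot := by
    rw [nhdsWithin_Ioo_eq_nhdsGT hs1]; infer_instance
  have hgs : g s = r := by
    refine le_antisymm ?_ hsA.2
    refine le_of_tendsto (hgc.continuousWithinAt (s := Set.Ioo s 1) (x := s)) ?_
    filter_upwards [self_mem_nhdsWithin] with t ht using (hlt t ht).le
  refine ⟨s, ⟨hsA.1.1, hs1⟩, fun c hc => ?_⟩
  have h2 : c ≤ s * m s - φ s := by
    have hcont : Continuous (fun t => t * m t - φ t) := by fun_prop
    refine ge_of_tendsto (hcont.continuousWithinAt (s := Set.Ioo s 1) (x := s)) ?_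
    filter_upwards [self_mem_nhdsWithin] with t ht
    exact hc t ⟨hsA.1.1.trans ht.1.le, ht.2.le⟩ (hlt t ht)
  rw [le_div_iff₀ (by linarith)]
  have : c * (1 - s) ≤ (s * m s - φ s) * (1 - s) :=
    mul_le_mul_of_nonneg_right h2 (by linarith)
  have h3 : -φ s - (1 - s) * m s = r := hgs
  have h4 : s * (-φ s - (1 - s) * m s) = s * r := by rw [h3]
  linarith

end HelperClassical

section HelperFinal
open Matrix

variable {d : ℕ}

lemma tensorPow_trace (A : Matrix (Fin d) (Fin d) ℂ) (hA : A.trace = 1) (n : ℕ) :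
    (tensorPow A n).trace = 1 := by
  have h := Finset.prod_univ_sum (fun _ : Fin n => (Finset.univ : Finset (Fin d)))
    (fun _ i => A i i)
  simp only [Fintype.piFinset_univ, Finset.prod_const, Finset.card_univ, Fintype.card_fin] at h
  have hA' : ∑ i, A i i = 1 := hA
  rw [hA', one_pow] at h
  exact h.symm

lemma direct_seq {ι : Type*} [Fintype ι] [DecidableEq ι] (A B T : Matrix ι ι ℂ)
    (hA : A.trace = 1) (hB : B.trace = 1) (hAp : A.PosSemidef) (hBp : B.PosSemidef)
    (hT : T.PosSemidef) (hT1 : (1 - T).PosSemidef) (ε δ : ℝ) (hε0 : 0 ≤ ε) (hε1 : ε ≤ 1)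
    (hδ0 : 0 ≤ δ) (hδ1 : δ ≤ 1)
    (hα : (A * (1 - T)).trace.re ≤ ε) (hβ : (B * T).trace.re ≤ δ) :
    ∃ T' : Matrix ι ι ℂ, T'.PosSemidef ∧ (1 - T').PosSemidef ∧
      (1 - δ) * ε ≤ (A * (1 - T')).trace.re ∧ (A * (1 - T')).trace.re ≤ 2 * ε ∧
      δ ≤ (B * T').trace.re ∧ (B * T').trace.re ≤ 2 * δ := by
  have kα := trace_mul_nonneg' A _ hAp hT1
  have kβ := trace_mul_nonneg' B _ hBp hT
  have hone : (1 : Matrix ι ι ℂ).PosSemidef := Matrix.PosSemidef.one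
  have smul_psd : ∀ (x : ℝ) (M : Matrix ι ι ℂ), 0 ≤ x → M.PosSemidef →
      ((x : ℂ) • M).PosSemidef := by
    intro x M hx hM
    exact hM.smul (by exact_mod_cast hx)
  have h1ε : 0 ≤ 1 - ε := by linarith
  have h1δ : 0 ≤ 1 - δ := by linarith
  have hc : (1 : Matrix ι ι ℂ) - ((((1 - δ) * (1 - ε) : ℝ) : ℂ) • T + ((δ : ℝ) : ℂ) • 1)
      = (((1 - δ) * (1 - ε) : ℝ) : ℂ) • (1 - T) + (((1 - δ) * ε : ℝ) : ℂ) • 1 := by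
    push_cast
    module
  refine ⟨(((1 - δ) * (1 - ε) : ℝ) : ℂ) • T + ((δ : ℝ) : ℂ) • 1, ?_, ?_, ?_⟩
  · exact (smul_psd _ _ (mul_nonneg h1δ h1ε) hT).add (smul_psd _ _ hδ0 hone)
  · rw [hc]
    exact (smul_psd _ _ (mul_nonneg h1δ h1ε) hT1).add
      (smul_psd _ _ (mul_nonneg h1δ hε0) hone)
  · have eα : (A * ((((1 - δ) * (1 - ε) : ℝ) : ℂ) • (1 - T)
        + (((1 - δ) * ε : ℝ) : ℂ) • 1)).trace.re
        = (1 - δ) * (1 - ε) * (A * (1 - T)).trace.re + (1 - δ) * ε := by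
      rw [Matrix.mul_add, Matrix.mul_smul, Matrix.mul_smul, Matrix.trace_add, Matrix.trace_smul,
        Matrix.trace_smul, Matrix.mul_one, hA, Complex.add_re, smul_eq_mul, smul_eq_mul,
        Complex.re_ofReal_mul, Complex.re_ofReal_mul]
      simp
    have eβ : (B * ((((1 - δ) * (1 - ε) : ℝ) : ℂ) • T + ((δ : ℝ) : ℂ) • 1)).trace.re
        = (1 - δ) * (1 - ε) * (B * T).trace.re + δ := by
      rw [Matrix.mul_add, Matrix.mul_smul, Matrix.mul_smul, Matrix.trace_add, Matrix.trace_smul,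
        Matrix.trace_smul, Matrix.mul_one, hB, Complex.add_re, smul_eq_mul, smul_eq_mul,
        Complex.re_ofReal_mul, Complex.re_ofReal_mul]
      simp
    rw [hc, eα, eβ]
    have hq0 : 0 ≤ (1 - δ) * (1 - ε) := mul_nonneg h1δ h1ε
    have hq1 : (1 - δ) * (1 - ε) ≤ 1 := by nlinarith
    have z1 := mul_nonneg hq0 kα
    have z2 := mul_nonneg hq0 kβ
    have z3 := mul_le_of_le_one_left kα hq1
    have z4 := mul_le_of_le_one_left kβ hq1
    have z5 : (1 - δ) * ε ≤ ε := mul_le_of_le_one_left hε0 (by linarith)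
    exact ⟨by linarith, by linarith, by linarith, by linarith⟩

lemma trace_test_le_one {ι : Type*} [Fintype ι] [DecidableEq ι] (B T : Matrix ι ι ℂ)
    (hB : B.trace = 1) (hBp : B.PosSemidef)
    (hT1 : (1 - T).PosSemidef) : (B * T).trace.re ≤ 1 := by
  have := trace_mul_nonneg' B _ hBp hT1
  rw [Matrix.mul_sub, Matrix.mul_one, Matrix.trace_sub, hB, Complex.sub_re] at this
  simp at this
  linarith

lemma mpow_eq_specM (A : Matrix (Fin d) (Fin d) ℂ) (hA : A.IsHermitian) (t : ℝ) :
    mpow A t = specM (hA.eigenvectorUnitary : Matrix _ _ ℂ) (fun i => hA.eigenvalues i ^ t) := by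
  unfold mpow
  rw [dif_pos hA]
  rfl

lemma mlog_eq_specM (A : Matrix (Fin d) (Fin d) ℂ) (hA : A.IsHermitian) :
    mlog A = specM (hA.eigenvectorUnitary : Matrix _ _ ℂ)
      (fun i => Real.log (hA.eigenvalues i)) := by
  unfold mlog
  rw [dif_pos hA]
  rfl

/-- The core statement in terms of spectral data. -/
lemma hoeffding_core (U V : Matrix (Fin d) (Fin d) ℂ)
    (hU : U ∈ Matrix.unitaryGroup (Fin d) ℂ) (hV : V ∈ Matrix.unitaryGroup (Fin d) ℂ)
    (l m : Fin d → ℝ) (hl : ∀ i, 0 < l i) (hm : ∀ i, 0 < m i)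
    (hρ1 : (specM U l).trace = 1) (hσ1 : (specM V m).trace = 1)
    (φ : ℝ → ℝ)
    (hφ : ∀ s, φ s = Real.log
      ((specM U (fun i => l i ^ (1 - s)) * specM V (fun i => m i ^ s)).trace.re))
    (r : ℝ) (hr1 : 0 < r)
    (hr2 : r ≤ (specM U l * (specM U (fun i => Real.log (l i))
      - specM V (fun i => Real.log (m i)))).trace.re) :
    sSup {c : ℝ |
      ∃ T : (n : ℕ) → Matrix (Fin n → Fin d) (Fin n → Fin d) ℂ,
        (∀ n, (T n).PosSemidef ∧ (1 - T n).PosSemidef) ∧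
        limsup (fun n : ℕ =>
          (1 / (n : ℝ)) * Real.log (((tensorPow (specM V m) n * T n).trace).re)) atTop ≤ -r ∧
        Tendsto (fun n : ℕ =>
          (1 / (n : ℝ)) * Real.log (((tensorPow (specM U l) n * (1 - T n)).trace).re))
          atTop (nhds (-c))}
      = ⨆ s : Set.Ico (0 : ℝ) 1, (-(s : ℝ) * r - φ (s : ℝ)) / (1 - (s : ℝ)) := by
  -- classical data
  set w : Fin d × Fin d → ℝ := fun o => Complex.normSq ((Uᴴ * V) o.1 o.2) with hw
  set a : Fin d × Fin d → ℝ := fun o => Real.log (l o.1) with ha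
  set b : Fin d × Fin d → ℝ := fun o => Real.log (m o.2) with hb
  have hw0 : ∀ o, 0 ≤ w o := fun o => Complex.normSq_nonneg _
  have hea : ∀ o, Real.exp (a o) = l o.1 := fun o => Real.exp_log (hl _)
  have heb : ∀ o, Real.exp (b o) = m o.2 := fun o => Real.exp_log (hm _)
  have hZ : ∀ s, (specM U (fun i => l i ^ (1 - s)) * specM V (fun i => m i ^ s)).trace.re
      = cZ w a b s := by
    intro s
    rw [specM_trace_mul, cZ, Fintype.sum_prod_type]
    refine Finset.sum_congr rfl fun i _ => Finset.sum_congr rfl fun j _ => ?_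
    rw [Real.exp_add, Real.rpow_def_of_pos (hl i), Real.rpow_def_of_pos (hm j),
      mul_comm (1 - s) (a _), mul_comm s (b _), mul_comm]
  have hφZ : ∀ s, φ s = Real.log (cZ w a b s) := fun s => by rw [hφ, hZ]
  have hZ0 : cZ w a b 0 = 1 := by
    rw [← hZ]
    simp only [sub_zero, Real.rpow_one, Real.rpow_zero, specM_one V hV, Matrix.mul_one, hρ1,
      Complex.one_re]
  have hZ1 : cZ w a b 1 = 1 := by
    rw [← hZ]
    simp only [sub_self, Real.rpow_one, Real.rpow_zero, specM_one U hU, Matrix.one_mul, hσ1,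
      Complex.one_re]
  have hZpos := cZ_pos w a b hw0 hZ0
  have hφ0 : φ 0 = 0 := by rw [hφZ, hZ0, Real.log_one]
  have hφ1 : φ 1 = 0 := by rw [hφZ, hZ1, Real.log_one]
  have hm0 : r ≤ -φ 0 - cm w a b 0 := by
    refine hr2.trans (le_of_eq ?_)
    rw [hφ0, cm, hZ0, div_one, Matrix.mul_sub, specM_mul U hU, Matrix.trace_sub, Complex.sub_re,
      specM_trace_mul]
    have h1 : (specM U fun i => l i * Real.log (l i)).trace.re
        = ∑ i, ∑ j, l i * Real.log (l i) * 1 * Complex.normSq ((Uᴴ * V) i j) := by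
      rw [← specM_trace_mul U V (fun i => l i * Real.log (l i)) (fun _ => 1), specM_one V hV,
        Matrix.mul_one]
    rw [h1, Fintype.sum_prod_type, ← Finset.sum_sub_distrib, neg_zero, zero_sub,
      ← Finset.sum_neg_distrib]
    refine Finset.sum_congr rfl fun i _ => ?_
    rw [← Finset.sum_sub_distrib, ← Finset.sum_neg_distrib]
    refine Finset.sum_congr rfl fun j _ => ?_
    simp only [sub_zero, one_mul, zero_mul, add_zero, hea]
    simp only [hw, ha, hb]
    ring
  have hφc : Continuous φ := by
    have : φ = fun s => Real.log (cZ w a b s) := funext hφZ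
    rw [this]
    exact (cZ_continuous w a b).log fun s => (hZpos s).ne'
  obtain ⟨s₀, hs₀, hcrit⟩ := exists_crit φ (cm w a b) hφc (cm_continuous w a b hw0 hZ0) r hr1 hm0 hφ1
  -- n-fold data
  have hUn := tensorPow_unitary U hU
  have hVn := tensorPow_unitary V hV
  have hln : ∀ (n : ℕ) (v : Fin n → Fin d), 0 ≤ ∏ t, l (v t) := fun n v =>
    Finset.prod_nonneg fun t _ => (hl _).le
  have hmn : ∀ (n : ℕ) (v : Fin n → Fin d), 0 ≤ ∏ t, m (v t) := fun n v =>
    Finset.prod_nonneg fun t _ => (hm _).le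
  have hKn : ∀ (n : ℕ) (v u : Fin n → Fin d),
      Complex.normSq (((tensorPow U n)ᴴ * tensorPow V n) v u) = ∏ t, w (v t, u t) := by
    intro n v u
    rw [← tensorPow_conjTranspose, ← tensorPow_mul, normSq_tensorPow]
  have hρn : ∀ n, (tensorPow (specM U l) n).PosSemidef := fun n => by
    rw [tensorPow_specM]; exact specM_posSemidef _ _ (hln n)
  have hσn : ∀ n, (tensorPow (specM V m) n).PosSemidef := fun n => by
    rw [tensorPow_specM]; exact specM_posSemidef _ _ (hmn n)
  have hρt := tensorPow_trace _ hρ1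
  have hσt := tensorPow_trace _ hσ1
  set 𝒮 : Set ℝ := {c : ℝ |
      ∃ T : (n : ℕ) → Matrix (Fin n → Fin d) (Fin n → Fin d) ℂ,
        (∀ n, (T n).PosSemidef ∧ (1 - T n).PosSemidef) ∧
        limsup (fun n : ℕ =>
          (1 / (n : ℝ)) * Real.log (((tensorPow (specM V m) n * T n).trace).re)) atTop ≤ -r ∧
        Tendsto (fun n : ℕ =>
          (1 / (n : ℝ)) * Real.log (((tensorPow (specM U l) n * (1 - T n)).trace).re))
          atTop (nhds (-c))} with h𝒮
  -- converse
  have hconv : ∀ c ∈ 𝒮, c ≤ (-s₀ * r - φ s₀) / (1 - s₀) := by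
    rintro c ⟨T, hT, hlim, htend⟩
    refine hcrit c fun t ht hlt => ?_
    obtain ⟨Vr, _, hlow⟩ := classical_lower w a b hw0 t ht (hZpos t)
    refine converse_rate _ _ (fun n => trace_mul_nonneg' _ _ (hσn n) (hT n).1)
      (fun n => trace_test_le_one _ _ (hσt n) (hσn n) (hT n).2) (φ t) (cm w a b t) t Vr r c
      ?_ hr1 hlt hlim htend
    intro n δ hn hδ
    rw [hφZ]
    refine (hlow n δ hn hδ).trans ?_
    have h := nussbaum (tensorPow U n) (tensorPow V n) (hUn n) (hVn n) _ _ (hln n) (hmn n) (T n)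
      (hT n).1 (hT n).2 (Real.exp (-(n * cm w a b t))) (Real.exp_nonneg _)
    rw [tensorPow_specM, tensorPow_specM]
    refine le_trans (le_of_eq ?_) h
    rw [← sum_pairs_eq]
    refine Finset.sum_congr rfl fun v _ => Finset.sum_congr rfl fun u _ => ?_
    simp only [hea, heb, hKn]
  -- direct part
  have hdir : ∀ s ∈ Set.Ico (0 : ℝ) 1, 0 ≤ (-s * r - φ s) / (1 - s) →
      (-s * r - φ s) / (1 - s) ∈ 𝒮 := by
    intro s hs hc0
    have h1s : 0 < 1 - s := by linarith [hs.2]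
    set c := (-s * r - φ s) / (1 - s) with hc
    set A := (r + φ s) / (1 - s) with hA
    have hceq : c = -(A * s) - φ s := by
      rw [hc, hA]; field_simp; ring
    have hreq : r = A * (1 - s) - φ s := by
      rw [hA]; field_simp; ring
    have hex : ∀ n : ℕ, ∃ T : Matrix (Fin n → Fin d) (Fin n → Fin d) ℂ,
        T.PosSemidef ∧ (1 - T).PosSemidef ∧
        (1 - Real.exp (-(n * r))) * Real.exp (-(n * c)) ≤
          (tensorPow (specM U l) n * (1 - T)).trace.re ∧
        (tensorPow (specM U l) n * (1 - T)).trace.re ≤ 2 * Real.exp (-(n * c)) ∧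
        Real.exp (-(n * r)) ≤ (tensorPow (specM V m) n * T).trace.re ∧
        (tensorPow (specM V m) n * T).trace.re ≤ 2 * Real.exp (-(n * r)) := by
      intro n
      obtain ⟨T, hT, hT1, hle⟩ := audenaert (tensorPow U n) (tensorPow V n) (hUn n) (hVn n)
        (fun v => ∏ t, l (v t)) (fun v => Real.exp (n * A) * ∏ t, m (v t)) (hln n)
        (fun v => mul_nonneg (Real.exp_nonneg _) (hmn n v)) s ⟨hs.1, hs.2.le⟩
      have hsc : specM (tensorPow V n) (fun v => Real.exp (n * A) * ∏ t, m (v t))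
          = ((Real.exp (n * A) : ℝ) : ℂ) • tensorPow (specM V m) n := by
        rw [tensorPow_specM]
        unfold specM
        rw [← Matrix.smul_mul, ← Matrix.mul_smul, ← Matrix.diagonal_smul]
        congr 3
        ext v
        simp
      have hsum : ∑ v : Fin n → Fin d, ∑ u : Fin n → Fin d,
          (∏ t, l (v t)) ^ (1 - s) * (Real.exp (n * A) * ∏ t, m (u t)) ^ s
            * Complex.normSq (((tensorPow U n)ᴴ * tensorPow V n) v u)
          = Real.exp (n * A * s) * Real.exp (n * φ s) := by
        have e1 : Real.exp (n * φ s) = (cZ w a b s) ^ n := by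
          rw [hφZ, mul_comm, ← Real.rpow_def_of_pos (hZpos s), Real.rpow_natCast]
        rw [e1, cZ, ← sum_pi_prod, ← sum_pairs_eq, Finset.mul_sum]
        refine Finset.sum_congr rfl fun v _ => ?_
        rw [Finset.mul_sum]
        refine Finset.sum_congr rfl fun u _ => ?_
        rw [hKn, Real.mul_rpow (Real.exp_nonneg _) (hmn n u), ← Real.exp_mul,
          ← Real.finsetProd_rpow _ _ (fun t _ => (hl _).le),
          ← Real.finsetProd_rpow _ _ (fun t _ => (hm _).le), Finset.prod_mul_distrib]
        have e2 : ∏ t, Real.exp ((1 - s) * a (v t, u t) + s * b (v t, u t))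
            = (∏ t, l (v t) ^ (1 - s)) * ∏ t, m (u t) ^ s := by
          rw [← Finset.prod_mul_distrib]
          refine Finset.prod_congr rfl fun t _ => ?_
          rw [Real.exp_add, Real.rpow_def_of_pos (hl _), Real.rpow_def_of_pos (hm _),
            mul_comm (1 - s) (a _), mul_comm s (b _)]
        rw [e2]
        ring
      rw [hsum, hsc, ← tensorPow_specM, Matrix.smul_mul, Matrix.trace_smul, smul_eq_mul,
        Complex.re_ofReal_mul] at hle
      have kα := trace_mul_nonneg' _ _ (hρn n) hT1
      have kβ := trace_mul_nonneg' _ _ (hσn n) hT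
      have kβ' := mul_nonneg (Real.exp_nonneg (n * A)) kβ
      have hn0 : (0 : ℝ) ≤ n := Nat.cast_nonneg n
      refine direct_seq _ _ T (hρt n) (hσt n) (hρn n) (hσn n) hT hT1 (Real.exp (-(n * c)))
        (Real.exp (-(n * r))) (Real.exp_nonneg _) ?_ (Real.exp_nonneg _) ?_ ?_ ?_
      · rw [Real.exp_le_one_iff]; nlinarith
      · rw [Real.exp_le_one_iff]; nlinarith
      · have : Real.exp (n * A * s) * Real.exp (n * φ s) = Real.exp (-(n * c)) := by
          rw [← Real.exp_add, hceq]; congr 1; ring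
        linarith
      · have : Real.exp (n * A * s) * Real.exp (n * φ s)
            = Real.exp (n * A) * Real.exp (-(n * r)) := by
          rw [← Real.exp_add, ← Real.exp_add, hreq]; congr 1; ring
        refine le_of_mul_le_mul_left ?_ (Real.exp_pos (n * A))
        linarith
    choose T hT1 hT2 hT3 hT4 hT5 hT6 using hex
    refine ⟨T, fun n => ⟨hT1 n, hT2 n⟩, ?_, ?_⟩
    · have := tendsto_log_rate (fun n => (tensorPow (specM V m) n * T n).trace.re) 1 2 r one_pos
        (Eventually.of_forall fun n => by rw [one_mul]; exact hT5 n)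
        (Eventually.of_forall fun n => hT6 n)
      exact this.limsup_eq.le
    · have hk : 0 < 1 - Real.exp (-r) := by
        have : Real.exp (-r) < 1 := by rw [Real.exp_lt_one_iff]; linarith
        linarith
      refine tendsto_log_rate (fun n => (tensorPow (specM U l) n * (1 - T n)).trace.re)
        (1 - Real.exp (-r)) 2 c hk ?_ (Eventually.of_forall fun n => hT4 n)
      filter_upwards [eventually_ge_atTop 1] with n hn
      refine le_trans ?_ (hT3 n)
      have hn1 : (1 : ℝ) ≤ n := by exact_mod_cast hn
      gcongr
      nlinarith
  have h00 : (0 : ℝ) ∈ 𝒮 := by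
    have := hdir 0 ⟨le_refl _, one_pos⟩
    simpa [hφ0] using this
  have hs₀nn : 0 ≤ (-s₀ * r - φ s₀) / (1 - s₀) := hconv 0 h00
  have hG : IsGreatest 𝒮 ((-s₀ * r - φ s₀) / (1 - s₀)) := ⟨hdir s₀ hs₀ hs₀nn, hconv⟩
  rw [hG.csSup_eq]
  have hG2 : IsGreatest (Set.range fun s : Set.Ico (0 : ℝ) 1 =>
      (-(s : ℝ) * r - φ (s : ℝ)) / (1 - (s : ℝ))) ((-s₀ * r - φ s₀) / (1 - s₀)) := by
    refine ⟨⟨⟨s₀, hs₀⟩, rfl⟩, ?_⟩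
    rintro _ ⟨s, rfl⟩
    by_cases h : 0 ≤ (-(s : ℝ) * r - φ (s : ℝ)) / (1 - (s : ℝ))
    · exact hconv _ (hdir s s.2 h)
    · exact (not_le.1 h).le.trans hs₀nn
  exact hG2.csSup_eq.symm

lemma posDef_data (A : Matrix (Fin d) (Fin d) ℂ) (hA : A.PosDef) :
    ∃ U ∈ Matrix.unitaryGroup (Fin d) ℂ, ∃ l : Fin d → ℝ, (∀ i, 0 < l i) ∧ A = specM U l ∧
      (∀ t, mpow A t = specM U (fun i => l i ^ t)) ∧
      mlog A = specM U (fun i => Real.log (l i)) :=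
  ⟨_, hA.1.eigenvectorUnitary.2, _, hA.eigenvalues_pos, herm_eq_specM A hA.1,
    mpow_eq_specM A hA.1, mlog_eq_specM A hA.1⟩

end HelperFinal

/-- The quantum Hoeffding bound (Theorem 1): for `0 < r ≤ D(ρ‖σ)`,
`B(r|ρ‖σ) = max_{0≤s<1}(−s·r − φ(s))/(1−s)`, where `B(r|ρ‖σ)` is the supremum of all `c`
achievable as `−lim (1/n)·log αₙ[Tₙ]` by test sequences with
`limsup (1/n)·log βₙ[Tₙ] ≤ −r`. -/
theorem quantum_hoeffding_bound {d : ℕ} (ρ σ : Matrix (Fin d) (Fin d) ℂ)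
    (hρ : ρ.PosDef) (hρ1 : ρ.trace = 1)
    (hσ : σ.PosDef) (hσ1 : σ.trace = 1)
    (B : ℝ → ℝ)
    (hB : ∀ r, B r = sSup {c : ℝ |
      ∃ T : (n : ℕ) → Matrix (Fin n → Fin d) (Fin n → Fin d) ℂ,
        (∀ n, (T n).PosSemidef ∧ (1 - T n).PosSemidef) ∧
        limsup (fun n : ℕ =>
          (1 / (n : ℝ)) * Real.log (((tensorPow σ n * T n).trace).re)) atTop ≤ -r ∧
        Tendsto (fun n : ℕ =>
          (1 / (n : ℝ)) * Real.log (((tensorPow ρ n * (1 - T n)).trace).re))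
          atTop (nhds (-c))})
    (r : ℝ) (hr1 : 0 < r) (hr2 : r ≤ qRelEnt ρ σ) :
    B r = ⨆ s : Set.Ico (0 : ℝ) 1, (-(s : ℝ) * r - qphi ρ σ (s : ℝ)) / (1 - (s : ℝ)) := by
  obtain ⟨U, hU, l, hl, eρ, pρ, lρ⟩ := posDef_data ρ hρ
  obtain ⟨V, hV, m, hm, eσ, pσ, lσ⟩ := posDef_data σ hσ
  have hφ : ∀ s, qphi ρ σ s = Real.log
      ((specM U (fun i => l i ^ (1 - s)) * specM V (fun i => m i ^ s)).trace.re) := by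
    intro s
    rw [qphi, pρ, pσ]
  rw [qRelEnt, lρ, lσ] at hr2
  generalize qphi ρ σ = φ at hφ ⊢
  rw [hB r]
  subst eρ
  subst eσ
  exact hoeffding_core U V hU hV l m hl hm hρ1 hσ1 φ hφ r hr1 hr2
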